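/- Let 𝓕(x) = (x^k + b)^n + c·∑_{i=1}^{n} a^{i-1} (x^k + b)^{n-i} ∈ ℤ[x] be irreducible of degree nk over ℚ, let θ be a root of 𝓕, and K = ℚ(θ). Let p be a prime divisor of the discriminant 𝔇_𝓕 with p ∤ ca and p ∣ k; write k = p^j s′ with p ∤ s′, and set h(x) = (x^{s′} + b)^n + c·∑_{i=1}^{n} a^{i-1} (x^{s′} + b)^{n-i}. Then p does not divide the index [ℤ_K : ℤ[θ]] if and only if the polynomials (1/p)·(𝓕(x) − h(x)^{p^j}) and h(x) are coprime modulo p. -/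

import Mathlib

open Polynomial

/-- `D` is the discriminant of the integer polynomial `f`: writing the roots of `f`
in `ℂ` as `θ_1, …, θ_d` (so that `f` splits as `∏ (X - θ_i)` over `ℂ`),
`D = ∏_{i < j} (θ_i - θ_j)^2`. -/
def IsDiscriminant (f : Polynomial ℤ) (D : ℤ) : Prop :=
  ∃ θ : Fin f.natDegree → ℂ,
    f.map (algebraMap ℤ ℂ) = ∏ i, (X - C (θ i)) ∧
      (D : ℂ) = ∏ i, ∏ j ∈ Finset.Ioi i, (θ i - θ j) ^ 2

theorem Polynomial.map_intCastRingHom_eq_zero_iff (p : ℕ) (P : ℤ[X]) :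
    P.map (Int.castRingHom (ZMod p)) = 0 ↔ ∃ R : ℤ[X], P = C (p : ℤ) * R := by
  change _ ↔ C (p : ℤ) ∣ P
  rw [C_dvd_iff_dvd_coeff, Polynomial.ext_iff]
  simp [ZMod.intCast_zmod_eq_zero_iff_dvd]

theorem Polynomial.exists_eq_add_C_mul_of_map_eq {p : ℕ} {P Q : ℤ[X]}
    (h : P.map (Int.castRingHom (ZMod p)) = Q.map (Int.castRingHom (ZMod p))) :
    ∃ R : ℤ[X], P = Q + C (p : ℤ) * R := by
  obtain ⟨R, hR⟩ := (map_intCastRingHom_eq_zero_iff p (P - Q)).1 (by simp [h])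
  exact ⟨R, by rw [← hR]; ring⟩

theorem Polynomial.exists_map_intCastRingHom_eq {p : ℕ} (P : (ZMod p)[X]) :
    ∃ Q : ℤ[X], Q.map (Int.castRingHom (ZMod p)) = P :=
  map_surjective _ (ZMod.ringHom_surjective _) P

/-- If `h` and `φ * g` agree modulo `p`, then `φ` times its complementary factor
`φ ^ (q - 1) * g ^ q` agrees with `h ^ q` up to `p` times a multiple of `φ` modulo `p`. -/
theorem Polynomial.exists_eq_mul_add_of_eq_pow_add {p q : ℕ} (hq : 2 ≤ q)
    {F h M φ g r : ℤ[X]} (hF : F = h ^ q + C (p : ℤ) * M) (hr : h = φ * g + C (p : ℤ) * r) :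
    ∃ u v : ℤ[X],
      F = φ * (φ ^ (q - 1) * g ^ q) + C (p : ℤ) * (M + φ * u + C (p : ℤ) * v) := by
  obtain ⟨m, rfl⟩ := Nat.exists_eq_add_of_le' hq
  obtain ⟨k, hk⟩ := powAddExpansion (φ * g) (C (p : ℤ) * r) (m + 2)
  refine ⟨((m + 2 : ℕ) : ℤ[X]) * φ ^ m * g ^ (m + 1) * r, k * r ^ 2, ?_⟩
  rw [hF, hr, hk]
  simp only [show m + 2 - 1 = m + 1 by omega]
  ring

/-- In an integrally closed domain, a fraction stabilising the ideal generated by two elements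
`x ≠ 0` and `y` is an element of the ring. -/
theorem IsIntegrallyClosed.dvd_of_mul_eq_add {B : Type*} [CommRing B] [IsDomain B]
    [IsIntegrallyClosed B] {x y s t w z e : B} (hx : x ≠ 0) (hs : s = x * t + y * w)
    (hsy : s * y = x * (x * e + y * z)) : x ∣ s := by
  have hx' : algebraMap B (FractionRing B) x ≠ 0 := by
    simpa using hx
  have hint : IsIntegral B (algebraMap B (FractionRing B) s / algebraMap B (FractionRing B) x) := by
    refine ⟨(X - C t) * (X - C z) - C (w * e), ?_, ?_⟩
    · refine ((monic_X_sub_C t).mul (monic_X_sub_C z)).sub_of_left ?_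
      refine degree_C_le.trans_lt ?_
      rw [degree_mul, degree_X_sub_C, degree_X_sub_C]
      decide
    · have h1 : (s - x * t) * (s - x * z) = x ^ 2 * (w * e) := by
        rw [show s - x * t = y * w by rw [hs]; ring]
        linear_combination w * hsy
      have h2 := congrArg (algebraMap B (FractionRing B)) h1
      simp only [map_mul, map_sub, map_pow] at h2
      simp only [eval₂_sub, eval₂_mul, eval₂_X, eval₂_C, map_mul]
      field_simp
      linear_combination h2
  obtain ⟨b, hb⟩ := IsIntegrallyClosed.isIntegral_iff.1 hint
  refine ⟨b, IsFractionRing.injective B (FractionRing B) ?_⟩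
  rw [map_mul, hb]
  field_simp

theorem dvd_aeval_of_map_dvd {B : Type*} [CommRing B] [IsDomain B] [CharZero B]
    [IsIntegrallyClosed B] {θ : B} {p q : ℕ} (hp : p.Prime) (hq : 2 ≤ q)
    {F h M φ g : ℤ[X]} (hF : F = h ^ q + C (p : ℤ) * M) (hθ : aeval θ F = 0)
    (hφ : h.map (Int.castRingHom (ZMod p)) = (φ * g).map (Int.castRingHom (ZMod p)))
    (hM : φ.map (Int.castRingHom (ZMod p)) ∣ M.map (Int.castRingHom (ZMod p))) :
    (p : B) ∣ aeval θ (φ ^ (q - 1) * g ^ q) := by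
  obtain ⟨r, hr⟩ := exists_eq_add_C_mul_of_map_eq hφ
  obtain ⟨u, v, huv⟩ := exists_eq_mul_add_of_eq_pow_add hq hF hr
  obtain ⟨c, hc⟩ := hM
  obtain ⟨d, rfl⟩ := exists_map_intCastRingHom_eq c
  obtain ⟨e, rfl⟩ := exists_eq_add_C_mul_of_map_eq (hc.trans (Polynomial.map_mul _).symm)
  obtain ⟨m, rfl⟩ := Nat.exists_eq_add_of_le' hq
  rw [huv] at hθ
  simp only [show m + 2 - 1 = m + 1 by omega, map_add, map_mul, map_pow,
    map_natCast] at hθ ⊢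
  refine IsIntegrallyClosed.dvd_of_mul_eq_add (y := aeval θ φ) (t := 0)
    (w := aeval θ φ ^ m * aeval θ g ^ (m + 2)) (z := -(aeval θ d + aeval θ u))
    (e := -(aeval θ e + aeval θ v))
    (Nat.cast_ne_zero.2 hp.ne_zero) (by ring) ?_
  linear_combination hθ

theorem not_dvd_aeval_of_isCoprime {B : Type*} [CommRing B] [IsDomain B] [CharZero B]
    [Algebra.IsIntegral ℤ B] {θ : B} {p q : ℕ} (hp : p.Prime) (hq : 2 ≤ q)
    {F h M φ g : ℤ[X]} (hF : F = h ^ q + C (p : ℤ) * M) (hθ : aeval θ F = 0)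
    (hker : ∀ G : ℤ[X], aeval θ G = 0 → F ∣ G)
    (hφ : h.map (Int.castRingHom (ZMod p)) = (φ * g).map (Int.castRingHom (ZMod p)))
    (hirr : ¬ IsUnit (φ.map (Int.castRingHom (ZMod p))))
    (hM : IsCoprime (M.map (Int.castRingHom (ZMod p))) (φ.map (Int.castRingHom (ZMod p)))) :
    ¬ (p : B) ∣ aeval θ (φ ^ (q - 1) * g ^ q) := by
  rintro ⟨x, hx⟩
  obtain ⟨r, hr⟩ := exists_eq_add_C_mul_of_map_eq hφ
  obtain ⟨u, v, huv⟩ := exists_eq_mul_add_of_eq_pow_add hq hF hr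
  set I : Ideal ℤ[X] := Ideal.span {C (p : ℤ), φ} with hI
  have hpI : C (p : ℤ) ∈ I := Ideal.subset_span (by simp)
  have hφI : φ ∈ I := Ideal.subset_span (by simp)
  have hFI : F ∈ I := by
    rw [huv]
    exact I.add_mem (I.mul_mem_right _ hφI) (I.mul_mem_right _ hpI)
  have hIne : I ≠ ⊤ := by
    intro hI'
    obtain ⟨s, t, hst⟩ := Ideal.mem_span_pair.1 ((Ideal.eq_top_iff_one I).1 hI')
    apply hirr
    have := congrArg (Polynomial.map (Int.castRingHom (ZMod p))) hst
    simp only [Polynomial.map_add, Polynomial.map_mul, Polynomial.map_one,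
      map_natCast, Polynomial.map_natCast, CharP.cast_eq_zero, mul_zero, zero_add] at this
    exact IsUnit.of_mul_eq_one_right _ this
  let f : ℤ[X] →+* B := (aeval θ : ℤ[X] →ₐ[ℤ] B).toRingHom
  have hf : ∀ G, f G = aeval θ G := fun _ => rfl
  have hfint : f.IsIntegral := by
    refine RingHom.IsIntegral.tower_top (algebraMap ℤ ℤ[X]) f ?_
    rw [show f.comp (algebraMap ℤ ℤ[X]) = algebraMap ℤ B from RingHom.ext_int _ _]
    exact algebraMap_isIntegral_iff.2 inferInstance
  have hkerI : RingHom.ker f ≤ I := fun G hG => I.mem_of_dvd (hker G hG) hFI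
  apply hIne
  rw [← Ideal.map_eq_top_iff_of_ker_le f hkerI hfint, Ideal.eq_top_iff_one]
  have hpJ : (p : B) ∈ I.map f := by
    simpa [hf] using Ideal.mem_map_of_mem f hpI
  have hφJ : aeval θ φ ∈ I.map f := Ideal.mem_map_of_mem f hφI
  have hMJ : aeval θ M ∈ I.map f := by
    have h0 : (p : B) * (x * aeval θ φ + aeval θ M + aeval θ φ * aeval θ u + p * aeval θ v)
        = 0 := by
      rw [← hθ, huv]
      rw [map_add, map_mul (aeval θ) φ, hx]
      simp only [map_add, map_mul, map_natCast]
      ring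
    have h1 := (mul_eq_zero.1 h0).resolve_left (Nat.cast_ne_zero.2 hp.ne_zero)
    rw [show aeval θ M = (-x - aeval θ u) * aeval θ φ + (- aeval θ v) * p by
      linear_combination h1]
    exact Ideal.add_mem _ (Ideal.mul_mem_left _ _ hφJ) (Ideal.mul_mem_left _ _ hpJ)
  obtain ⟨s, t, hst⟩ := hM
  obtain ⟨s, rfl⟩ := exists_map_intCastRingHom_eq s
  obtain ⟨t, rfl⟩ := exists_map_intCastRingHom_eq t
  obtain ⟨w, hw⟩ := exists_eq_add_C_mul_of_map_eq (p := p) (P := 1) (Q := s * M + t * φ)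
    (by simp [hst])
  have h1 := congrArg (aeval θ) hw
  simp only [map_one, map_add, map_mul, map_natCast] at h1
  rw [h1]
  exact Ideal.add_mem _ (Ideal.add_mem _ (Ideal.mul_mem_left _ _ hMJ)
    (Ideal.mul_mem_left _ _ hφJ)) (Ideal.mul_mem_right _ _ hpJ)

/-- A class of order `p` modulo `ℤ[θ]` yields one represented by a complementary factor of an
irreducible factor of `h` modulo `p`. -/
theorem exists_factor_dvd_aeval {B : Type*} [CommRing B] [IsDomain B] [CharZero B]
    {θ : B} {p q : ℕ} (hp : p.Prime) (hq : 2 ≤ q)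
    {F h M : ℤ[X]} (hF : F = h ^ q + C (p : ℤ) * M) (hFm : F.Monic) (hθ : aeval θ F = 0)
    {x : B} (hx : ∀ R : ℤ[X], aeval θ R ≠ x) {G : ℤ[X]} (hG : aeval θ G = p * x) :
    ∃ φ g : ℤ[X], Irreducible (φ.map (Int.castRingHom (ZMod p))) ∧
      h.map (Int.castRingHom (ZMod p)) = (φ * g).map (Int.castRingHom (ZMod p)) ∧
      (p : B) ∣ aeval θ (φ ^ (q - 1) * g ^ q) := by
  classical
  have : Fact p.Prime := ⟨hp⟩
  have hp0 : (p : B) ≠ 0 := Nat.cast_ne_zero.2 hp.ne_zero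
  set π := Int.castRingHom (ZMod p) with hπ
  have hF0 : F.map π ≠ 0 := (hFm.map π).ne_zero
  have hFh : F.map π = h.map π ^ q := by simp [hF, hπ]
  obtain ⟨e, he⟩ := EuclideanDomain.gcd_dvd_right (G.map π) (F.map π)
  have he_unit : ¬ IsUnit e := by
    intro hu
    have hdvd : F.map π ∣ G.map π := by
      rw [he, hu.mul_right_dvd]
      exact EuclideanDomain.gcd_dvd_left _ _
    obtain ⟨t, ht⟩ := hdvd
    obtain ⟨t, rfl⟩ := exists_map_intCastRingHom_eq t
    obtain ⟨R, hR⟩ := exists_eq_add_C_mul_of_map_eq (p := p) (ht.trans (Polynomial.map_mul π).symm)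
    apply hx R
    apply mul_left_cancel₀ hp0
    rw [← hG, hR]
    simp [hθ]
  have he0 : e ≠ 0 := by
    rintro rfl
    exact hF0 (by simpa using he)
  obtain ⟨φ, hφ, e', rfl⟩ := WfDvdMonoid.exists_irreducible_factor he_unit he0
  have hφh : φ ∣ h.map π := by
    refine hφ.prime.dvd_of_dvd_pow (n := q) ?_
    rw [← hFh, he]
    exact ⟨EuclideanDomain.gcd (G.map π) (F.map π) * e', by ring⟩
  obtain ⟨g, hg⟩ := hφh
  obtain ⟨φ, rfl⟩ := exists_map_intCastRingHom_eq φ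
  obtain ⟨g, rfl⟩ := exists_map_intCastRingHom_eq g
  obtain ⟨e', rfl⟩ := exists_map_intCastRingHom_eq e'
  refine ⟨φ, g, hφ, by rw [hg, Polynomial.map_mul], ?_⟩
  have hbez := EuclideanDomain.gcd_eq_gcd_ab (G.map π) (F.map π)
  obtain ⟨a, ha⟩ := exists_map_intCastRingHom_eq (EuclideanDomain.gcdA (G.map π) (F.map π))
  obtain ⟨b, hb⟩ := exists_map_intCastRingHom_eq (EuclideanDomain.gcdB (G.map π) (F.map π))
  obtain ⟨m, rfl⟩ := Nat.exists_eq_add_of_le' hq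
  have hψ : (φ ^ (m + 2 - 1) * g ^ (m + 2)).map π = (G * a * e' + F * b * e').map π := by
    apply mul_left_cancel₀ hφ.ne_zero
    rw [← ha, ← hb] at hbez
    simp only [Polynomial.map_mul, Polynomial.map_pow, Polynomial.map_add,
      show m + 2 - 1 = m + 1 by omega]
    calc _ = F.map π := by rw [hFh, hg]; ring
      _ = _ := by
        conv_lhs => rw [he, hbez]
        ring
  obtain ⟨R, hR⟩ := exists_eq_add_C_mul_of_map_eq hψ
  refine ⟨x * aeval θ a * aeval θ e' + aeval θ R, ?_⟩
  rw [hR]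
  simp only [map_add, map_mul, hG, hθ, map_natCast]
  ring

/-- A form of Dedekind's index criterion for `F ≡ h ^ q` modulo `p` with `2 ≤ q`. -/
theorem exists_mul_mem_adjoin_iff_not_isCoprime {B : Type*} [CommRing B] [IsDomain B] [CharZero B]
    [Algebra.IsIntegral ℤ B] [IsIntegrallyClosed B] {θ : B} {p q : ℕ} (hp : p.Prime) (hq : 2 ≤ q)
    {F h M : ℤ[X]} (hF : F = h ^ q + C (p : ℤ) * M) (hFm : F.Monic) (hθ : aeval θ F = 0)
    (hker : ∀ G : ℤ[X], aeval θ G = 0 → F ∣ G) :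
    (∃ x : B, x ∉ Algebra.adjoin ℤ {θ} ∧ (p : B) * x ∈ Algebra.adjoin ℤ {θ}) ↔
      ¬ IsCoprime (M.map (Int.castRingHom (ZMod p))) (h.map (Int.castRingHom (ZMod p))) := by
  have : Fact p.Prime := ⟨hp⟩
  set π := Int.castRingHom (ZMod p) with hπ
  have hF0 : F.map π ≠ 0 := (hFm.map π).ne_zero
  have hFh : F.map π = h.map π ^ q := by simp [hF, hπ]
  simp only [Algebra.adjoin_singleton_eq_range_aeval, AlgHom.mem_range, not_exists]
  constructor
  · rintro ⟨x, hx, G, hG⟩ hcop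
    obtain ⟨φ, g, hφ, hφg, hdvd⟩ := exists_factor_dvd_aeval hp hq hF hFm hθ hx hG
    refine not_dvd_aeval_of_isCoprime hp hq hF hθ hker hφg hφ.not_isUnit
      (hcop.of_isCoprime_of_dvd_right ?_) hdvd
    rw [hφg, Polynomial.map_mul]
    exact dvd_mul_right _ _
  · intro hcop
    have hh0 : h.map π ≠ 0 := by
      intro h0
      exact hF0 (by rw [hFh, h0, zero_pow (by omega)])
    have : ∃ φ, Irreducible φ ∧ φ ∣ M.map π ∧ φ ∣ h.map π := by
      by_contra! hcon
      exact hcop (isCoprime_of_irreducible_dvd (fun h => hh0 h.2) hcon)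
    obtain ⟨φ, hφ, hφM, g, hg⟩ := this
    obtain ⟨φ, rfl⟩ := exists_map_intCastRingHom_eq φ
    obtain ⟨g, rfl⟩ := exists_map_intCastRingHom_eq g
    obtain ⟨x, hx⟩ := dvd_aeval_of_map_dvd hp hq hF hθ (hg.trans (Polynomial.map_mul π).symm) hφM
    refine ⟨x, fun R hR => ?_, _, hx⟩
    obtain ⟨t, ht⟩ := hker (φ ^ (q - 1) * g ^ q - C (p : ℤ) * R) (by simp [← hR, hx])
    have h1 := congrArg (Polynomial.map π) ht
    simp only [Polynomial.map_sub, Polynomial.map_mul, map_natCast,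
      Polynomial.map_natCast, CharP.cast_eq_zero, zero_mul, sub_zero] at h1
    obtain ⟨m, rfl⟩ := Nat.exists_eq_add_of_le' hq
    have h2 : F.map π * (φ.map π * t.map π) = F.map π * 1 := by
      rw [mul_left_comm, ← h1, hFh, hg]
      simp only [Polynomial.map_pow, show m + 2 - 1 = m + 1 by omega]
      ring
    exact hφ.not_isUnit (IsUnit.of_mul_eq_one _ (mul_left_cancel₀ hF0 h2))

theorem AddSubgroup.prime_dvd_index_iff {G : Type*} [AddCommGroup G] (S : AddSubgroup G)
    [Finite (G ⧸ S)] {p : ℕ} (hp : p.Prime) :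
    p ∣ S.index ↔ ∃ x, x ∉ S ∧ p • x ∈ S := by
  have : Fact p.Prime := ⟨hp⟩
  constructor
  · intro h
    obtain ⟨y, hy⟩ := exists_prime_addOrderOf_dvd_card' (G := G ⧸ S) p h
    obtain ⟨x, rfl⟩ := QuotientAddGroup.mk_surjective y
    refine ⟨x, fun hx => ?_, ?_⟩
    · rw [(QuotientAddGroup.eq_zero_iff x).2 hx, addOrderOf_zero] at hy
      exact hp.one_lt.ne hy
    · rw [← QuotientAddGroup.eq_zero_iff, QuotientAddGroup.mk_nsmul, ← hy, addOrderOf_nsmul_eq_zero]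
  · rintro ⟨x, hx, hpx⟩
    have : addOrderOf (x : G ⧸ S) = p := by
      apply addOrderOf_eq_prime
      · rwa [← QuotientAddGroup.mk_nsmul, QuotientAddGroup.eq_zero_iff]
      · rwa [Ne, QuotientAddGroup.eq_zero_iff]
    rw [← this]
    exact _root_.addOrderOf_dvd_natCard (x : G ⧸ S)

theorem NumberField.RingOfIntegers.finite_quotient_adjoin {K : Type*} [Field K] [NumberField K]
    (θ : NumberField.RingOfIntegers K) (hgen : Algebra.adjoin ℚ {(θ : K)} = ⊤) :
    Finite (NumberField.RingOfIntegers K ⧸ (Algebra.adjoin ℤ {θ}).toSubring.toAddSubgroup) := by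
  have htors : Module.IsTorsion ℤ
      (NumberField.RingOfIntegers K ⧸ Subalgebra.toSubmodule (Algebra.adjoin ℤ {θ})) := by
    intro y
    obtain ⟨x, rfl⟩ := Submodule.Quotient.mk_surjective _ y
    have hx : (x : K) ∈ Algebra.adjoin ℚ {(θ : K)} := hgen ▸ Algebra.mem_top
    rw [Algebra.adjoin_singleton_eq_range_aeval] at hx
    obtain ⟨P, hP⟩ := hx
    obtain ⟨b, hb0, hb⟩ := IsLocalization.integerNormalization_spec (nonZeroDivisors ℤ) P
    refine ⟨⟨b, hb0⟩, ?_⟩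
    rw [Submonoid.smul_def, ← Submodule.Quotient.mk_smul, Submodule.Quotient.mk_eq_zero,
      Subalgebra.mem_toSubmodule, Algebra.adjoin_singleton_eq_range_aeval]
    refine ⟨IsLocalization.integerNormalization (nonZeroDivisors ℤ) P, ?_⟩
    apply NumberField.RingOfIntegers.coe_injective
    have h1 := congrArg (aeval (θ : K)) hb
    rw [aeval_map_algebraMap] at h1
    rw [map_zsmul] at h1
    change _ = b • aeval (θ : K) P at h1
    change aeval (θ : K) P = x at hP
    rw [hP] at h1
    change algebraMap _ K (aeval θ _) = algebraMap _ K (b • x)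
    rw [← aeval_algebraMap_apply, map_zsmul]
    exact h1
  have hfin := Module.finite_of_fg_torsion _ htors
  exact hfin

theorem Polynomial.Monic.pow_add_C_mul_sum {P : ℤ[X]} (hP : P.Monic) (hd : 0 < P.natDegree)
    (n : ℕ) (a c : ℤ) :
    (P ^ n + C c * ∑ i ∈ Finset.Icc 1 n, C a ^ (i - 1) * P ^ (n - i)).Monic := by
  refine (hP.pow n).add_of_left ?_
  rw [← smul_eq_C_mul]
  refine (degree_smul_le _ _).trans_lt ?_
  rw [(hP.pow n).ne_zero |> degree_eq_natDegree]
  refine (degree_sum_le _ _).trans_lt ?_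
  rw [Finset.sup_lt_iff (WithBot.bot_lt_coe _)]
  intro i hi
  rw [Finset.mem_Icc] at hi
  rw [← C_pow, ← smul_eq_C_mul]
  refine (degree_smul_le _ _).trans_lt ?_
  rw [(hP.pow _).ne_zero |> degree_eq_natDegree, hP.natDegree_pow, hP.natDegree_pow]
  exact_mod_cast Nat.mul_lt_mul_of_pos_right (by omega) hd

theorem stmt_11
    (n k : ℕ) (hn : 3 ≤ n) (hk : 1 ≤ k) (a b c : ℤ)
    (F : Polynomial ℤ)
    (hF : F = (X ^ k + C b) ^ n +
        C c * ∑ i ∈ Finset.Icc 1 n, C a ^ (i - 1) * (X ^ k + C b) ^ (n - i))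
    (hFdeg : F.natDegree = n * k)
    (hFirr : Irreducible (F.map (algebraMap ℤ ℚ)))
    (K : Type*) [Field K] [NumberField K]
    (θ : NumberField.RingOfIntegers K)
    (hθ : aeval θ F = 0)
    (hgen : Algebra.adjoin ℚ {(θ : K)} = ⊤)
    (D : ℤ) (hD : IsDiscriminant F D)
    (p : ℕ) (hp : p.Prime) (hpD : (p : ℤ) ∣ D)
    (hpca : ¬ (p : ℤ) ∣ c * a) (hpk : p ∣ k)
    (j s' : ℕ) (hks : k = p ^ j * s') (hps' : ¬ p ∣ s')
    (h : Polynomial ℤ)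
    (hh : h = (X ^ s' + C b) ^ n +
        C c * ∑ i ∈ Finset.Icc 1 n, C a ^ (i - 1) * (X ^ s' + C b) ^ (n - i))
    (M : Polynomial ℤ) (hM : C (p : ℤ) * M = F - h ^ p ^ j) :
    (¬ p ∣ (Algebra.adjoin ℤ {θ}).toSubring.toAddSubgroup.index) ↔
      IsCoprime (M.map (Int.castRingHom (ZMod p)))
        (h.map (Int.castRingHom (ZMod p))) := by
  have hFm : F.Monic := by
    rw [hF]
    refine (monic_X_pow_add_C b (by omega)).pow_add_C_mul_sum ?_ n a c
    rw [natDegree_X_pow_add_C]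
    omega
  have hj : j ≠ 0 := by
    rintro rfl
    exact hps' (by simpa [hks] using hpk)
  have hq : 2 ≤ p ^ j := hp.two_le.trans (Nat.le_self_pow hj p)
  have hFM : F = h ^ p ^ j + C (p : ℤ) * M := by rw [hM]; ring
  have hθK : ∀ G : ℤ[X], aeval (θ : K) (G.map (algebraMap ℤ ℚ)) = (aeval θ G : K) := by
    intro G
    rw [aeval_map_algebraMap]
    exact aeval_algebraMap_apply K θ G
  have hmin : F.map (algebraMap ℤ ℚ) = minpoly ℚ (θ : K) :=
    minpoly.eq_of_irreducible_of_monic hFirr (by rw [hθK, hθ]; rfl) (hFm.map _)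
  have hker : ∀ G : ℤ[X], aeval θ G = 0 → F ∣ G := by
    intro G hG
    rw [← map_dvd_map (algebraMap ℤ ℚ) (algebraMap ℤ ℚ).injective_int hFm, hmin]
    exact minpoly.dvd ℚ _ (by rw [hθK, hG]; rfl)
  have := NumberField.RingOfIntegers.finite_quotient_adjoin θ hgen
  rw [AddSubgroup.prime_dvd_index_iff _ hp, not_iff_comm,
    ← exists_mul_mem_adjoin_iff_not_isCoprime hp hq hFM hFm hθ hker]
  simp only [nsmul_eq_mul]
  rfl
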